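/- arXiv:2203.04652 — 2 statements merged into one kernel-verified Lean document; each statement's English description precedes it below -/
import Mathlib

section
/- Let G be a connected graph such that J_G is strongly unmixed, let B be a block of G, and let V be the set of cut vertices of G belonging to V(B). Then for every subset W ⊆ V, J_{B̄^W} is strongly unmixed. In particular, J_{B̄} is strongly unmixed. -/
open SimpleGraph

universe u u'

/-- The number of connected components of the induced subgraph of `G` on the vertex set `A`. -/
noncomputable def cComp {V : Type u} (G : SimpleGraph V) (A : Set V) : ℕ :=
  Nat.card (G.induce A).ConnectedComponent

/-- `x` is a cut vertex of the induced subgraph of `G` on `A`: removing `x`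
increases the number of connected components. -/
def CutVertexOn {V : Type u} (G : SimpleGraph V) (A : Set V) (x : V) : Prop :=
  x ∈ A ∧ cComp G A < cComp G (A \ {x})

/-- `T` is a cutset of the induced subgraph of `G` on `A`: every `t ∈ T` is a
cut vertex of `G[A] ∖ (T ∖ {t})`. -/
def CutsetOn {V : Type u} [DecidableEq V] (G : SimpleGraph V) (A : Set V) (T : Finset V) :
    Prop :=
  ↑T ⊆ A ∧ ∀ t ∈ T, CutVertexOn G (A \ ↑(T.erase t)) t

/-- The binomial edge ideal of the induced subgraph of `G` on `A` is unmixed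
(combinatorial characterization): `c(T) = |T| + c(∅)` for every cutset `T`. -/
def UnmixedOn {V : Type u} [DecidableEq V] (G : SimpleGraph V) (A : Set V) : Prop :=
  ∀ T : Finset V, CutsetOn G A T → cComp G (A \ ↑T) = T.card + cComp G A

/-- The induced subgraph of `G` on `A` is accessible. -/
def AccessibleOn {V : Type u} [DecidableEq V] (G : SimpleGraph V) (A : Set V) : Prop :=
  UnmixedOn G A ∧
    ∀ T : Finset V, CutsetOn G A T → T.Nonempty → ∃ t ∈ T, CutsetOn G A (T.erase t)

/-- The graph `(G[A])_x`: add all edges between neighbours of `x` lying in `A`. -/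
def cliqueAtOn {V : Type u} (G : SimpleGraph V) (A : Set V) (x : V) : SimpleGraph V :=
  G ⊔ SimpleGraph.fromRel (fun a b => a ∈ A ∧ b ∈ A ∧ G.Adj x a ∧ G.Adj x b)

/-- The binomial edge ideal of the induced subgraph of `G` on `A` is strongly unmixed. -/
inductive StronglyUnmixedOn {V : Type u} [DecidableEq V] : SimpleGraph V → Set V → Prop
  | complete (G : SimpleGraph V) (A : Set V)
      (h : ∀ a b : A, (G.induce A).Reachable a b → a ≠ b → (G.induce A).Adj a b) :
      StronglyUnmixedOn G A
  | cut (G : SimpleGraph V) (A : Set V) (hU : UnmixedOn G A) (x : V)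
      (hx : CutVertexOn G A x)
      (h1 : StronglyUnmixedOn G (A \ {x}))
      (h2 : StronglyUnmixedOn (cliqueAtOn G A x) A)
      (h3 : StronglyUnmixedOn (cliqueAtOn G A x) (A \ {x})) :
      StronglyUnmixedOn G A

/-- `x` is a free vertex of `G`: the induced subgraph on `N(x) ∪ {x}` is complete. -/
def FreeVertex {V : Type u} (G : SimpleGraph V) (x : V) : Prop :=
  ∀ a b : V, G.Adj x a → G.Adj x b → a ≠ b → G.Adj a b

/-- Attach a whisker (pendant vertex) at each vertex of `Wv`.  `Sum.inl a` is the
original vertex `a` and `Sum.inr x` is the whisker vertex `f_x` attached at `x ∈ Wv`. -/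
def whiskered {V : Type u} (G : SimpleGraph V) (Wv : Set V) : SimpleGraph (V ⊕ V) :=
  SimpleGraph.fromRel (fun a b =>
    (∃ x y, G.Adj x y ∧ a = Sum.inl x ∧ b = Sum.inl y) ∨
    (∃ x ∈ Wv, a = Sum.inl x ∧ b = Sum.inr x))

/-- `B` is (the vertex set of) a block of `G`: a maximal connected induced
subgraph having no cut vertex. -/
def IsBlock {V : Type u} (G : SimpleGraph V) (B : Set V) : Prop :=
  (G.induce B).Connected ∧ (∀ x, ¬ CutVertexOn G B x) ∧
    ∀ B' : Set V, B ⊆ B' → (G.induce B').Connected → (∀ x, ¬ CutVertexOn G B' x) → B' = B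

/-- Glue two graphs `G` and `H`, identifying the vertex `x` of `G` with the vertex
`y` of `H` (the identified vertex is `Sum.inl x`). -/
def glueAt {V : Type u} {W : Type u'} (G : SimpleGraph V) (H : SimpleGraph W) (x : V) (y : W) :
    SimpleGraph (V ⊕ W) :=
  SimpleGraph.fromRel (fun a b =>
    (∃ p q, G.Adj p q ∧ a = Sum.inl p ∧ b = Sum.inl q) ∨
    (∃ p q, H.Adj p q ∧ p ≠ y ∧ q ≠ y ∧ a = Sum.inr p ∧ b = Sum.inr q) ∨
    (∃ q, H.Adj y q ∧ a = Sum.inl x ∧ b = Sum.inr q))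

/-- The star product `K_m ⋆_r K_n`: two complete graphs, on `{x₁,…,x_m}` (the `inl`s)
and `{y₁,…,y_n}` (the `inr`s), together with the matching edges `{x_i, y_i}` for `1 ≤ i ≤ r`
(indices `0,…,r-1` here). -/
def starProd (m n r : ℕ) : SimpleGraph (Fin m ⊕ Fin n) :=
  SimpleGraph.fromRel (fun a b =>
    (∃ x y : Fin m, a = Sum.inl x ∧ b = Sum.inl y) ∨
    (∃ x y : Fin n, a = Sum.inr x ∧ b = Sum.inr y) ∨
    (∃ (x : Fin m) (y : Fin n), (x : ℕ) = (y : ℕ) ∧ (x : ℕ) < r ∧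
      a = Sum.inl x ∧ b = Sum.inr y))

/-- The vertices `x_i, y_i` for `2 ≤ i ≤ r` (indices `1,…,r-1` here), at which
whiskers are attached to form `overline(K_m ⋆_r K_n)`. -/
def starWhisk (m n r : ℕ) : Set (Fin m ⊕ Fin n) :=
  {a | (∃ x : Fin m, a = Sum.inl x ∧ 1 ≤ (x : ℕ) ∧ (x : ℕ) < r) ∨
       (∃ y : Fin n, a = Sum.inr y ∧ 1 ≤ (y : ℕ) ∧ (y : ℕ) < r)}

/-- `a` and `b` both lie in `A` and are joined by a path of the induced subgraph of `G` on `A`. -/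
def ReachIn {V : Type u} (G : SimpleGraph V) (A : Set V) (a b : V) : Prop :=
  ∃ (ha : a ∈ A) (hb : b ∈ A), (G.induce A).Reachable ⟨a, ha⟩ ⟨b, hb⟩

/-- Auxiliary (connected case): `G[A]` has no cut vertex, or for every cut vertex `x`,
every connected component of `G[A] ∖ {x}` contains at most `r` cut vertices of `G[A] ∖ {x}`. -/
def RCutConnAux {V : Type u} (G : SimpleGraph V) (A : Set V) (r : ℕ) : Prop :=
  (∀ x, ¬ CutVertexOn G A x) ∨
    ∀ x, CutVertexOn G A x → ∀ a ∈ A \ {x},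
      Set.ncard {w | CutVertexOn G (A \ {x}) w ∧ ReachIn G (A \ {x}) a w} ≤ r

/-- `G[A]` is `r`-cut-connected: every connected component of `G[A]` satisfies the
condition of `RCutConnAux`. -/
def RCutConn {V : Type u} (G : SimpleGraph V) (A : Set V) (r : ℕ) : Prop :=
  ∀ a ∈ A, RCutConnAux G {b | ReachIn G A a b} r

/-- `G[A]` is strongly `r`-cut-connected: it is `r`-cut-connected and, recursively,
`G[A] ∖ {x}` is strongly `r`-cut-connected for every cut vertex `x`. -/
inductive StronglyRCutConn {V : Type u} (r : ℕ) : SimpleGraph V → Set V → Prop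
  | mk (G : SimpleGraph V) (A : Set V) (h1 : RCutConn G A r)
      (h2 : ∀ x, CutVertexOn G A x → StronglyRCutConn r G (A \ {x})) :
      StronglyRCutConn r G A

/-- `φ` contracts the graph `G[A]` onto `H[A']`: its fibres are connected, adjacency in `H[A']` is
the existence of an edge between fibres, and each vertex of `H[A']` has either a one-point fibre
or a neighbourhood that is a clique. -/
structure IsFreeContraction {V : Type u} {V' : Type u'} (G : SimpleGraph V) (A : Set V)
    (H : SimpleGraph V') (A' : Set V') (φ : V → V') : Prop where
  maps : ∀ a ∈ A, φ a ∈ A'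
  surj : ∀ y ∈ A', ∃ a ∈ A, φ a = y
  conn : ∀ a ∈ A, ∀ b ∈ A, φ a = φ b → ReachIn G (A ∩ φ ⁻¹' {φ a}) a b
  adj_map : ∀ a ∈ A, ∀ b ∈ A, G.Adj a b → φ a ≠ φ b → H.Adj (φ a) (φ b)
  adj_lift : ∀ y ∈ A', ∀ z ∈ A', H.Adj y z → ∃ a ∈ A, ∃ b ∈ A, φ a = y ∧ φ b = z ∧ G.Adj a b
  free : ∀ y ∈ A', (∀ a ∈ A, ∀ b ∈ A, φ a = y → φ b = y → a = b) ∨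
    ∀ p ∈ A', ∀ q ∈ A', H.Adj y p → H.Adj y q → p ≠ q → H.Adj p q

theorem SimpleGraph.Reachable.of_forall_adj {V : Type u} {V' : Type u'} {G : SimpleGraph V}
    {H : SimpleGraph V'} (f : V → V') (hf : ∀ a b, G.Adj a b → H.Reachable (f a) (f b))
    {a b : V} (h : G.Reachable a b) : H.Reachable (f a) (f b) := by
  rw [reachable_iff_reflTransGen] at h
  induction h with
  | refl => exact Reachable.refl _
  | tail _ hbc ih => exact ih.trans (hf _ _ hbc)

theorem ReachIn.mono {V : Type u} {G G' : SimpleGraph V} {A B : Set V} (hG : G ≤ G')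
    (hAB : A ⊆ B) {a b : V} (h : ReachIn G A a b) : ReachIn G' B a b := by
  obtain ⟨ha, hb, h⟩ := h
  exact ⟨hAB ha, hAB hb, h.of_forall_adj (fun v : A => (⟨v, hAB v.2⟩ : B))
    fun _ _ hab => Adj.reachable (hG hab)⟩

theorem cComp_le_of_reachable {V : Type u} {V' : Type u'} [Finite V'] {G : SimpleGraph V}
    {H : SimpleGraph V'} {A : Set V} {A' : Set V'} (f : A → A')
    (hf : ∀ a b, (H.induce A').Reachable (f a) (f b) → (G.induce A).Reachable a b) :
    cComp G A ≤ cComp H A' := by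
  refine Nat.card_le_card_of_injective
    (fun c => (H.induce A').connectedComponentMk (f c.out)) fun c d hcd => ?_
  have h := ConnectedComponent.sound (hf _ _ (ConnectedComponent.exact hcd))
  have hc : (G.induce A).connectedComponentMk c.out = c := Quot.out_eq c
  have hd : (G.induce A).connectedComponentMk d.out = d := Quot.out_eq d
  rwa [hc, hd] at h

theorem not_cutVertexOn_of_free {V : Type u} [Finite V] {G : SimpleGraph V} {A : Set V} {y : V}
    (h : ∀ p ∈ A, ∀ q ∈ A, G.Adj y p → G.Adj y q → p ≠ q → G.Adj p q) :
    ¬ CutVertexOn G A y := by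
  rintro ⟨-, hlt⟩
  refine absurd hlt (not_lt.2 ?_)
  refine cComp_le_of_reachable (fun v => ⟨v, v.2.1⟩) fun a b hab => ?_
  have key : ∀ c : A, (G.induce A).Reachable ⟨a, a.2.1⟩ c →
      (∀ hc : (c : V) ≠ y, (G.induce (A \ {y})).Reachable a ⟨c, c.2, hc⟩) ∧
      ((c : V) = y → ∀ q, ∀ hq : q ∈ A \ {y}, G.Adj y q →
        (G.induce (A \ {y})).Reachable a ⟨q, hq⟩) := by
    intro c hc
    rw [reachable_iff_reflTransGen] at hc
    induction hc with
    | refl => exact ⟨fun _ => Reachable.refl _, fun h => absurd h a.2.2⟩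
    | @tail b c _ hbc ih =>
      have hbc' : G.Adj b c := hbc
      by_cases hb : (b : V) = y
      · refine ⟨fun hc => ih.2 hb c ⟨c.2, hc⟩ (hb ▸ hbc'), fun hc => ?_⟩
        exact absurd (hb.trans hc.symm) hbc'.ne
      · refine ⟨fun hc => (ih.1 hb).trans (Adj.reachable hbc'), fun hc q hq hyq => ?_⟩
        by_cases hbq : (b : V) = q
        · subst hbq
          exact ih.1 hb
        · exact (ih.1 hb).trans
            (Adj.reachable (h b b.2 q hq.1 (hc ▸ hbc'.symm) hyq hbq : G.Adj b q))
  exact (key _ hab).1 b.2.2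

theorem cliqueAtOn_adj {V : Type u} {G : SimpleGraph V} {A : Set V} {x a b : V} :
    (cliqueAtOn G A x).Adj a b ↔
      G.Adj a b ∨ (a ≠ b ∧ a ∈ A ∧ b ∈ A ∧ G.Adj x a ∧ G.Adj x b) := by
  simp only [cliqueAtOn, sup_adj, fromRel_adj]
  tauto

namespace IsFreeContraction

variable {V : Type u} {V' : Type u'} {G : SimpleGraph V} {A : Set V} {H : SimpleGraph V'}
  {A' : Set V'} {φ : V → V'}

theorem restrict (h : IsFreeContraction G A H A' φ) (T : Set V') :
    IsFreeContraction G (A \ φ ⁻¹' T) H (A' \ T) φ where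
  maps a ha := ⟨h.maps a ha.1, ha.2⟩
  surj y hy := by
    obtain ⟨a, ha, rfl⟩ := h.surj y hy.1
    exact ⟨a, ⟨ha, hy.2⟩, rfl⟩
  conn a ha b hb hab := by
    refine (h.conn a ha.1 b hb.1 hab).mono le_rfl ?_
    rintro c ⟨hc, hca⟩
    refine ⟨⟨hc, fun hcT => ha.2 ?_⟩, hca⟩
    have hca' : φ c = φ a := hca
    simpa only [Set.mem_preimage, hca'] using hcT
  adj_map a ha b hb := h.adj_map a ha.1 b hb.1
  adj_lift y hy z hz hyz := by
    obtain ⟨a, ha, b, hb, rfl, rfl, hab⟩ := h.adj_lift y hy.1 z hz.1 hyz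
    exact ⟨a, ⟨ha, hy.2⟩, b, ⟨hb, hz.2⟩, rfl, rfl, hab⟩
  free y hy := (h.free y hy.1).imp (fun h a ha b hb => h a ha.1 b hb.1)
    fun h p hp q hq => h p hp.1 q hq.1

theorem reachable_fibre (h : IsFreeContraction G A H A' φ) (a b : A) (hab : φ a = φ b) :
    (G.induce A).Reachable a b := by
  obtain ⟨_, _, hr⟩ := (h.conn a a.2 b b.2 hab).mono le_rfl Set.inter_subset_left
  exact hr

theorem reachable_map (h : IsFreeContraction G A H A' φ) {a b : A}
    (hab : (G.induce A).Reachable a b) :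
    (H.induce A').Reachable ⟨φ a, h.maps a a.2⟩ ⟨φ b, h.maps b b.2⟩ := by
  refine hab.of_forall_adj (fun a : A => (⟨φ a, h.maps a a.2⟩ : A')) fun a b hab => ?_
  by_cases hφ : φ a = φ b
  · simp only [hφ]
    exact Reachable.refl _
  · exact Adj.reachable (h.adj_map a a.2 b b.2 hab hφ : H.Adj (φ a) (φ b))

theorem reachable_lift (h : IsFreeContraction G A H A' φ) {y z : A'}
    (hyz : (H.induce A').Reachable y z) (a b : A) (ha : φ a = y) (hb : φ b = z) :
    (G.induce A).Reachable a b := by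
  choose s hs hφ using h.surj
  have key := hyz.of_forall_adj (H := G.induce A) (fun y : A' => (⟨s y y.2, hs y y.2⟩ : A))
    fun y z hyz => by
      obtain ⟨c, hc, d, hd, hcy, hdz, hcd⟩ := h.adj_lift y y.2 z z.2 hyz
      exact (h.reachable_fibre ⟨_, hs y y.2⟩ ⟨c, hc⟩ ((hφ _ _).trans hcy.symm)).trans
        ((Adj.reachable (G := G.induce A) (u := ⟨c, hc⟩) (v := ⟨d, hd⟩) hcd).trans
          (h.reachable_fibre ⟨d, hd⟩ ⟨_, hs z z.2⟩ (hdz.trans (hφ _ _).symm)))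
  exact (h.reachable_fibre a ⟨_, hs y y.2⟩ (ha.trans (hφ _ _).symm)).trans
    (key.trans (h.reachable_fibre ⟨_, hs z z.2⟩ b ((hφ _ _).trans hb.symm)))

theorem cComp_eq [Finite V] [Finite V'] (h : IsFreeContraction G A H A' φ) :
    cComp G A = cComp H A' := by
  apply le_antisymm
  · exact cComp_le_of_reachable (fun a => ⟨φ a, h.maps a a.2⟩)
      fun a b hab => h.reachable_lift hab a b rfl rfl
  · choose s hs hφ using h.surj
    refine cComp_le_of_reachable (fun y => ⟨s y y.2, hs y y.2⟩) fun y z hyz => ?_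
    have := h.reachable_map hyz
    simpa only [hφ] using this

theorem delete (h : IsFreeContraction G A H A' φ) {x : V}
    (hs : ∀ a ∈ A, φ a = φ x → a = x) : IsFreeContraction G (A \ {x}) H (A' \ {φ x}) φ := by
  have hA : A \ {x} = A \ φ ⁻¹' {φ x} := by
    ext a
    have ha := hs a
    have ha' : a = x → φ a = φ x := fun h => congrArg φ h
    simp only [Set.mem_sdiff, Set.mem_singleton_iff, Set.mem_preimage]
    tauto
  rw [hA]
  exact h.restrict {φ x}

theorem cutVertexOn [Finite V] [Finite V'] (h : IsFreeContraction G A H A' φ) {x : V}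
    (hx : x ∈ A) (hs : ∀ a ∈ A, φ a = φ x → a = x) (hc : CutVertexOn H A' (φ x)) :
    CutVertexOn G A x := by
  refine ⟨hx, ?_⟩
  rw [h.cComp_eq, (h.delete hs).cComp_eq]
  exact hc.2

theorem cliqueAt (h : IsFreeContraction G A H A' φ) {x : V} (hx : x ∈ A)
    (hs : ∀ a ∈ A, φ a = φ x → a = x) :
    IsFreeContraction (cliqueAtOn G A x) A (cliqueAtOn H A' (φ x)) A' φ where
  maps := h.maps
  surj := h.surj
  conn a ha b hb hab := (h.conn a ha b hb hab).mono le_sup_left le_rfl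
  adj_map a ha b hb hab hφ := by
    rw [cliqueAtOn_adj] at hab ⊢
    obtain hab | ⟨-, -, -, hxa, hxb⟩ := hab
    · exact Or.inl (h.adj_map a ha b hb hab hφ)
    · refine Or.inr ⟨hφ, h.maps a ha, h.maps b hb, h.adj_map x hx a ha hxa fun h => ?_,
        h.adj_map x hx b hb hxb fun h => ?_⟩
      · exact hxa.ne (hs a ha h.symm).symm
      · exact hxb.ne (hs b hb h.symm).symm
  adj_lift y hy z hz hyz := by
    rw [cliqueAtOn_adj] at hyz
    obtain hyz | ⟨hne, -, -, hxy, hxz⟩ := hyz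
    · obtain ⟨a, ha, b, hb, hay, hbz, hab⟩ := h.adj_lift y hy z hz hyz
      exact ⟨a, ha, b, hb, hay, hbz, cliqueAtOn_adj.2 (Or.inl hab)⟩
    · obtain ⟨a, ha, b, hb, hax, rfl, hab⟩ := h.adj_lift _ (h.maps x hx) y hy hxy
      obtain ⟨c, hc, d, hd, hcx, rfl, hcd⟩ := h.adj_lift _ (h.maps x hx) z hz hxz
      obtain rfl := hs a ha hax
      obtain rfl := hs c hc hcx
      exact ⟨b, hb, d, hd, rfl, rfl, cliqueAtOn_adj.2
        (Or.inr ⟨fun h => hne (congrArg φ h), hb, hd, hab, hcd⟩)⟩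
  free y hy := by
    refine (h.free y hy).imp id fun hf p hp q hq hyp hyq hpq => ?_
    rw [cliqueAtOn_adj] at hyp hyq ⊢
    by_cases hxy : H.Adj (φ x) y
    · have key : ∀ p ∈ A', H.Adj y p → p ≠ φ x → H.Adj (φ x) p := fun p hp hyp hne =>
        (hf p hp _ (h.maps x hx) hyp hxy.symm hne).symm
      by_cases hpx : p = φ x
      · subst hpx
        obtain hyq | ⟨-, -, -, -, hxq⟩ := hyq
        · exact Or.inl (key q hq hyq hpq.symm)
        · exact Or.inl hxq
      by_cases hqx : q = φ x
      · subst hqx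
        obtain hyp | ⟨-, -, -, -, hxp⟩ := hyp
        · exact Or.inl (key p hp hyp hpq).symm
        · exact Or.inl hxp.symm
      refine Or.inr ⟨hpq, hp, hq, ?_, ?_⟩
      · exact hyp.elim (fun h => key p hp h hpx) fun h => h.2.2.2.2
      · exact hyq.elim (fun h => key q hq h hqx) fun h => h.2.2.2.2
    · exact Or.inl (hf p hp q hq (hyp.resolve_right fun h => hxy h.2.2.2.1)
        (hyq.resolve_right fun h => hxy h.2.2.2.1) hpq)

theorem cliqueAt_of_free (h : IsFreeContraction G A H A' φ) {x : V} (hx : x ∈ A)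
    (hf : ∀ p ∈ A', ∀ q ∈ A', H.Adj (φ x) p → H.Adj (φ x) q → p ≠ q → H.Adj p q) :
    IsFreeContraction (cliqueAtOn G A x) A H A' φ where
  maps := h.maps
  surj := h.surj
  conn a ha b hb hab := (h.conn a ha b hb hab).mono le_sup_left le_rfl
  adj_map a ha b hb hab hφ := by
    rw [cliqueAtOn_adj] at hab
    obtain hab | ⟨-, -, -, hxa, hxb⟩ := hab
    · exact h.adj_map a ha b hb hab hφ
    by_cases hax : φ x = φ a
    · exact hax ▸ h.adj_map x hx b hb hxb (hax ▸ hφ)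
    by_cases hbx : φ x = φ b
    · exact hbx ▸ (h.adj_map x hx a ha hxa hax).symm
    · exact hf _ (h.maps a ha) _ (h.maps b hb) (h.adj_map x hx a ha hxa hax)
        (h.adj_map x hx b hb hxb hbx) hφ
  adj_lift y hy z hz hyz := by
    obtain ⟨a, ha, b, hb, hay, hbz, hab⟩ := h.adj_lift y hy z hz hyz
    exact ⟨a, ha, b, hb, hay, hbz, cliqueAtOn_adj.2 (Or.inl hab)⟩
  free := h.free

theorem unmixedOn [Finite V] [Finite V'] [DecidableEq V] [DecidableEq V']
    (h : IsFreeContraction G A H A' φ) (hU : UnmixedOn G A) : UnmixedOn H A' := by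
  rintro T ⟨hTA, hT⟩
  have hinj : ∀ t ∈ T, ∀ a ∈ A, ∀ b ∈ A, φ a = t → φ b = t → a = b := by
    intro t ht
    refine (h.free t (hTA ht)).resolve_right fun hfree => ?_
    exact not_cutVertexOn_of_free (fun p hp q hq => hfree p hp.1 q hq.1) (hT t ht)
  have hfin : (A ∩ φ ⁻¹' ↑T).Finite := Set.toFinite _
  have hmem : ∀ a, a ∈ hfin.toFinset ↔ a ∈ A ∧ φ a ∈ T := by simp
  have hdiff : A \ ↑hfin.toFinset = A \ φ ⁻¹' ↑T := by
    ext a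
    simp +contextual
  have hcard : hfin.toFinset.card = T.card := by
    refine Finset.card_bij (fun a _ => φ a) (fun a ha => ((hmem a).1 ha).2) ?_ ?_
    · intro a ha b hb hab
      exact hinj _ ((hmem b).1 hb).2 a ((hmem a).1 ha).1 b ((hmem b).1 hb).1 hab rfl
    · intro t ht
      obtain ⟨a, ha, rfl⟩ := h.surj t (hTA ht)
      exact ⟨a, (hmem a).2 ⟨ha, ht⟩, rfl⟩
  have hcut : CutsetOn G A hfin.toFinset := by
    refine ⟨fun a ha => ((hmem a).1 ha).1, fun a ha => ?_⟩
    have haA := ((hmem a).1 ha).1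
    have haT := ((hmem a).1 ha).2
    have herase : A \ ↑(hfin.toFinset.erase a) = A \ φ ⁻¹' ↑(T.erase (φ a)) := by
      ext b
      have hb : b ∈ A → φ b = φ a → b = a := fun hb hba => hinj _ haT b hb a haA hba rfl
      have hb' : b = a → φ b = φ a := fun h => congrArg φ h
      simp only [Set.mem_sdiff, Finset.mem_coe, Finset.mem_erase, hmem, Set.mem_preimage]
      tauto
    have hres := h.restrict ↑(T.erase (φ a))
    rw [herase]
    refine hres.cutVertexOn ⟨haA, by simp⟩ (fun b hb hba => ?_) (hT _ haT)
    exact hinj _ haT b hb.1 a haA hba rfl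
  rw [← (h.restrict ↑T).cComp_eq, ← h.cComp_eq, ← hcard, ← hdiff]
  exact hU _ hcut

theorem stronglyUnmixedOn [Finite V] [Finite V'] [DecidableEq V] [DecidableEq V']
    (h : IsFreeContraction G A H A' φ) (hS : StronglyUnmixedOn G A) : StronglyUnmixedOn H A' := by
  induction hS generalizing H A' with
  | complete G A hG =>
    refine .complete _ _ fun y z hyz hne => ?_
    obtain ⟨a, ha, hay⟩ := h.surj y y.2
    obtain ⟨b, hb, hbz⟩ := h.surj z z.2
    have hφ : φ a ≠ φ b := by
      rw [hay, hbz]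
      exact fun h => hne (Subtype.ext h)
    have hab := hG ⟨a, ha⟩ ⟨b, hb⟩ (h.reachable_lift hyz _ _ hay hbz)
      fun h => hφ (congrArg φ (Subtype.ext_iff.1 h))
    have := h.adj_map a ha b hb hab hφ
    rwa [hay, hbz] at this
  | cut G A hU x hx _ _ _ ih1 ih2 ih3 =>
    obtain hs | hf := h.free (φ x) (h.maps x hx.1)
    · have hx' : ∀ a ∈ A, φ a = φ x → a = x := fun a ha hax => hs a ha x hx.1 hax rfl
      refine .cut _ _ (h.unmixedOn hU) (φ x) ?_ (ih1 (h.delete hx'))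
        (ih2 (h.cliqueAt hx.1 hx')) (ih3 ((h.cliqueAt hx.1 hx').delete hx'))
      exact ⟨h.maps x hx.1, by rw [← h.cComp_eq, ← (h.delete hx').cComp_eq]; exact hx.2⟩
    · exact ih2 (h.cliqueAt_of_free hx.1 hf)

end IsFreeContraction

theorem whiskered_adj_inl_inl {V : Type u} {G : SimpleGraph V} {W : Set V} {x y : V} :
    (whiskered G W).Adj (Sum.inl x) (Sum.inl y) ↔ G.Adj x y := by
  have := G.adj_comm x y
  have := G.ne_of_adj (a := x) (b := y)
  simp only [whiskered, fromRel_adj, Sum.inl.injEq, reduceCtorEq, and_false, exists_false,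
    or_false, exists_eq_right_right', ne_eq]
  grind

theorem whiskered_adj_inl_inr {V : Type u} {G : SimpleGraph V} {W : Set V} {x y : V} :
    (whiskered G W).Adj (Sum.inl x) (Sum.inr y) ↔ x = y ∧ x ∈ W := by
  simp only [whiskered, fromRel_adj, Sum.inl.injEq, Sum.inr.injEq, reduceCtorEq]
  grind

theorem whiskered_not_adj_inr_inr {V : Type u} {G : SimpleGraph V} {W : Set V} {x y : V} :
    ¬ (whiskered G W).Adj (Sum.inr x) (Sum.inr y) := by
  simp [whiskered, fromRel_adj]

/-- A connected graph whose parts `R w` are joined to the rest of the graph only through the vertex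
`w` contracts, by shrinking each `R w` to a point, onto the rest with whiskers attached. -/
theorem exists_isFreeContraction_whiskered {V : Type u} {G : SimpleGraph V} {W P : Set V}
    {R : V → Set V} (hconn : G.Connected) (hWP : W ⊆ P) (hR : ∀ w ∈ W, Disjoint (R w) P)
    (hdisj : ∀ w ∈ W, ∀ w' ∈ W, ∀ v ∈ R w, v ∈ R w' → w = w')
    (hcover : ∀ v, v ∉ P → ∃ w ∈ W, v ∈ R w)
    (hedge : ∀ w ∈ W, ∀ a ∈ R w, ∀ b, G.Adj a b → b = w ∨ b ∈ R w)
    (hRconn : ∀ w ∈ W, (G.induce (R w)).Connected) :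
    ∃ φ, IsFreeContraction G Set.univ (whiskered G W) (Sum.inl '' P ∪ Sum.inr '' W) φ := by
  classical
  have hex : ∀ v, ∃ y : V ⊕ V, (v ∈ P ∧ y = Sum.inl v) ∨ ∃ w ∈ W, v ∈ R w ∧ y = Sum.inr w := by
    intro v
    by_cases hv : v ∈ P
    · exact ⟨_, Or.inl ⟨hv, rfl⟩⟩
    · obtain ⟨w, hw, hvw⟩ := hcover v hv
      exact ⟨_, Or.inr ⟨w, hw, hvw, rfl⟩⟩
  choose φ hφ using hex
  have hnot : ∀ w ∈ W, ∀ v ∈ R w, v ∉ P := fun w hw v hv hvP => (hR w hw).le_bot ⟨hv, hvP⟩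
  have hφP : ∀ v ∈ P, φ v = Sum.inl v := by
    intro v hv
    obtain ⟨-, h⟩ | ⟨w, hw, hvw, -⟩ := hφ v
    · exact h
    · exact absurd hv (hnot w hw v hvw)
  have hφR : ∀ w ∈ W, ∀ v ∈ R w, φ v = Sum.inr w := by
    intro w hw v hv
    obtain ⟨h, -⟩ | ⟨w', hw', hvw, h⟩ := hφ v
    · exact absurd h (hnot w hw v hv)
    · rw [h, hdisj w hw w' hw' v hv hvw]
  have hinl : ∀ v y, φ v = Sum.inl y → v = y := by
    intro v y hvy
    obtain ⟨-, h⟩ | ⟨w, -, -, h⟩ := hφ v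
    · exact Sum.inl_injective (h.symm.trans hvy)
    · exact absurd (h.symm.trans hvy) (by simp)
  have hinr : ∀ v w, φ v = Sum.inr w → w ∈ W ∧ v ∈ R w := by
    intro v w hvw
    obtain ⟨-, h⟩ | ⟨w', hw', hv, h⟩ := hφ v
    · exact absurd (h.symm.trans hvw) (by simp)
    · obtain rfl := Sum.inr_injective (h.symm.trans hvw)
      exact ⟨hw', hv⟩
  have hadj : ∀ a b, G.Adj a b → φ a ≠ φ b → (whiskered G W).Adj (φ a) (φ b) := by
    have hside : ∀ w ∈ W, ∀ a ∈ R w, ∀ b, G.Adj a b → φ a ≠ φ b →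
        (whiskered G W).Adj (φ b) (φ a) := by
      intro w hw a ha b hab hne
      obtain rfl | hb := hedge w hw a ha b hab
      · rw [hφR _ hw a ha, hφP _ (hWP hw)]
        exact whiskered_adj_inl_inr.2 ⟨rfl, hw⟩
      · exact absurd ((hφR w hw a ha).trans (hφR w hw b hb).symm) hne
    intro a b hab hne
    obtain ⟨-, ha⟩ | ⟨w, hw, ha, -⟩ := hφ a
    · obtain ⟨-, hb⟩ | ⟨w, hw, hb, -⟩ := hφ b
      · rw [ha, hb]
        exact whiskered_adj_inl_inl.2 hab
      · exact hside w hw b hb a hab.symm hne.symm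
    · exact (hside w hw a ha b hab hne).symm
  have hattach : ∀ w ∈ W, ∃ a ∈ R w, G.Adj w a := by
    intro w hw
    by_contra! hcon
    obtain ⟨⟨v, hv⟩⟩ := (hRconn w hw).nonempty
    have hvw := hconn.preconnected v w
    rw [reachable_iff_reflTransGen] at hvw
    have hmem : w ∈ R w := by
      have : ∀ u, Relation.ReflTransGen G.Adj v u → u ∈ R w := by
        intro u hu
        induction hu with
        | refl => exact hv
        | @tail b c _ hbc ih =>
          refine (hedge w hw b ih c hbc).resolve_left ?_
          rintro rfl
          exact hcon b ih hbc.symm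
      exact this w hvw
    exact hnot w hw w hmem (hWP hw)
  refine ⟨φ, ⟨?_, ?_, ?_, fun a _ b _ => hadj a b, ?_, ?_⟩⟩
  · intro v _
    obtain ⟨hv, h⟩ | ⟨w, hw, -, h⟩ := hφ v
    · exact Or.inl ⟨v, hv, h.symm⟩
    · exact Or.inr ⟨w, hw, h.symm⟩
  · rintro _ (⟨v, hv, rfl⟩ | ⟨w, hw, rfl⟩)
    · exact ⟨v, trivial, hφP v hv⟩
    · obtain ⟨a, ha, -⟩ := hattach w hw
      exact ⟨a, trivial, hφR w hw a ha⟩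
  · intro a _ b _ hab
    obtain ⟨-, ha⟩ | ⟨w, hw, haw, ha⟩ := hφ a
    · obtain rfl := hinl b a (hab.symm.trans ha)
      exact ⟨⟨trivial, rfl⟩, ⟨trivial, rfl⟩, Reachable.refl _⟩
    · have hb := (hinr b w (hab.symm.trans ha)).2
      have : ReachIn G (R w) a b := ⟨haw, hb, (hRconn w hw).preconnected ⟨a, haw⟩ ⟨b, hb⟩⟩
      refine this.mono le_rfl fun c hc => ?_
      exact ⟨trivial, (hφR w hw c hc).trans ha.symm⟩
  · rintro _ (⟨y, hy, rfl⟩ | ⟨y, hy, rfl⟩) _ (⟨z, hz, rfl⟩ | ⟨z, hz, rfl⟩) hyz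
    · exact ⟨y, trivial, z, trivial, hφP y hy, hφP z hz, whiskered_adj_inl_inl.1 hyz⟩
    · obtain ⟨rfl, -⟩ := whiskered_adj_inl_inr.1 hyz
      obtain ⟨a, ha, hwa⟩ := hattach y hz
      exact ⟨y, trivial, a, trivial, hφP y hy, hφR y hz a ha, hwa⟩
    · obtain ⟨rfl, -⟩ := whiskered_adj_inl_inr.1 hyz.symm
      obtain ⟨a, ha, hwa⟩ := hattach z hy
      exact ⟨a, trivial, z, trivial, hφR z hy a ha, hφP z hz, hwa.symm⟩
    · exact absurd hyz whiskered_not_adj_inr_inr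
  · rintro _ (⟨y, -, rfl⟩ | ⟨w, -, rfl⟩)
    · exact Or.inl fun a _ b _ ha hb => (hinl a y ha).trans (hinl b y hb).symm
    · have huniq : ∀ p, (whiskered G W).Adj (Sum.inr w) p → p = Sum.inl w := by
        rintro (p | p) hp
        · rw [(whiskered_adj_inl_inr.1 hp.symm).1]
        · exact absurd hp whiskered_not_adj_inr_inr
      exact Or.inr fun p _ q _ hp hq hpq => absurd ((huniq p hp).trans (huniq q hq).symm) hpq

/-- if `G` is connected with `J_G` strongly unmixed, `B` a block of `G`
with cut-vertex set `C` and branch decomposition `G = B ∪ ⋃_{w ∈ C} G_w`, then for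
every `W ⊆ C`, `J_{B̄^W}` is strongly unmixed; in particular `J_{B̄}` is strongly
unmixed. -/
theorem stronglyUnmixed_block_whiskers {V : Type u} [Fintype V] [DecidableEq V]
    (G : SimpleGraph V) (B : Set V) (Gi : V → Set V) (C : Set V)
    (hconn : G.Connected) (hsu : StronglyUnmixedOn G Set.univ) (hB : IsBlock G B)
    (hC : C = {w | w ∈ B ∧ CutVertexOn G Set.univ w})
    (hcover : B ∪ ⋃ w ∈ C, Gi w = Set.univ)
    (hmeet : ∀ w ∈ C, Gi w ∩ B = {w})
    (hdisj : ∀ w ∈ C, ∀ w' ∈ C, w ≠ w' → Gi w ∩ Gi w' = ∅)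
    (hedge : ∀ a b : V, G.Adj a b → (a ∈ B ∧ b ∈ B) ∨ ∃ w ∈ C, a ∈ Gi w ∧ b ∈ Gi w)
    (hbranch : ∀ w ∈ C, (G.induce (Gi w \ {w})).Connected)
    (W : Set V) (hW : W ⊆ C) :
    StronglyUnmixedOn (whiskered G W)
      (Sum.inl '' (B ∪ ⋃ w ∈ C \ W, Gi w) ∪ Sum.inr '' W) := by
  have hwGi : ∀ w ∈ C, w ∈ Gi w ∧ w ∈ B := fun w hw =>
    (Set.ext_iff.1 (hmeet w hw) w).2 rfl
  have hGiB : ∀ w ∈ C, ∀ v ∈ Gi w, v ∈ B → v = w := fun w hw v hv hvB => by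
    have : v ∈ Gi w ∩ B := ⟨hv, hvB⟩
    rwa [hmeet w hw] at this
  have huniq : ∀ w ∈ C, ∀ w' ∈ C, ∀ v ∈ Gi w, v ∈ Gi w' → w = w' := by
    intro w hw w' hw' v hv hv'
    by_contra hne
    exact (hdisj w hw w' hw' hne).le ⟨hv, hv'⟩
  refine (exists_isFreeContraction_whiskered (G := G) (W := W)
    (P := B ∪ ⋃ w ∈ C \ W, Gi w) (R := fun w => Gi w \ {w}) hconn
    (fun w hw => Or.inl (hwGi w (hW hw)).2) ?_
    (fun w hw w' hw' v hv hv' => huniq w (hW hw) w' (hW hw') v hv.1 hv'.1) ?_ ?_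
    (fun w hw => hbranch w (hW hw))).elim fun φ hφ => hφ.stronglyUnmixedOn hsu
  · intro w hw
    rw [Set.disjoint_left]
    rintro v ⟨hv, hvw⟩ (hvB | hvU)
    · exact hvw (hGiB w (hW hw) v hv hvB)
    · simp only [Set.mem_iUnion] at hvU
      obtain ⟨w', hw', hv'⟩ := hvU
      exact hw'.2 (huniq w (hW hw) w' hw'.1 v hv hv' ▸ hw)
  · intro v hv
    have hvu : v ∈ B ∪ ⋃ w ∈ C, Gi w := hcover ▸ Set.mem_univ v
    have hvB : v ∉ B := fun h => hv (Or.inl h)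
    have hvU := hvu.resolve_left hvB
    simp only [Set.mem_iUnion] at hvU
    obtain ⟨w, hw, hvw⟩ := hvU
    refine ⟨w, ?_, hvw, fun h => hvB (h ▸ (hwGi w hw).2)⟩
    by_contra hwW
    exact hv (Or.inr (Set.mem_biUnion (⟨hw, hwW⟩ : w ∈ C \ W) hvw))
  · rintro w hw a ⟨ha, haw⟩ b hab
    obtain ⟨haB, -⟩ | ⟨w', hw', ha', hb'⟩ := hedge a b hab
    · exact absurd (hGiB w (hW hw) a ha haB) haw
    · obtain rfl := huniq w (hW hw) w' hw' a ha ha'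
      by_cases hbw : b = w
      · exact Or.inl hbw
      · exact Or.inr ⟨hb', hbw⟩
end

section
/- Let G = G₁ ∪ G₂ be a graph with V(G₁) ∩ V(G₂) = {v}, and for i = 1,2 let Ḡ_i be the graph obtained from G_i by adding a new vertex f_v and the whisker edge {v, f_v}. If J_G is unmixed and Ḡ₁ and Ḡ₂ are accessible, then G is accessible. -/
open SimpleGraph

universe u u'

/-- `a` and `b` are equal or joined by a path of `G` all of whose vertices lie in `A`. -/
def ReachWithin {V : Type*} (G : SimpleGraph V) (A : Set V) : V → V → Prop :=
  Relation.ReflTransGen (fun a b => a ∈ A ∧ b ∈ A ∧ G.Adj a b)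

namespace ReachWithin

variable {V W : Type*} {G : SimpleGraph V} {H : SimpleGraph W} {A : Set V} {B : Set W} {a b c : V}

theorem refl (a : V) : ReachWithin G A a a := Relation.ReflTransGen.refl

theorem of_adj (ha : a ∈ A) (hb : b ∈ A) (h : G.Adj a b) : ReachWithin G A a b :=
  Relation.ReflTransGen.single ⟨ha, hb, h⟩

theorem trans (h : ReachWithin G A a b) (h' : ReachWithin G A b c) : ReachWithin G A a c :=
  Relation.ReflTransGen.trans h h'

theorem symm (h : ReachWithin G A a b) : ReachWithin G A b a := by
  induction h with
  | refl => exact refl _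
  | tail _ h ih => exact (of_adj h.2.1 h.1 h.2.2.symm).trans ih

theorem map (f : V → W)
    (hf : ∀ a ∈ A, ∀ b ∈ A, G.Adj a b → ReachWithin H B (f a) (f b))
    (h : ReachWithin G A a b) : ReachWithin H B (f a) (f b) := by
  induction h with
  | refl => exact refl _
  | tail _ h ih => exact ih.trans (hf _ h.1 _ h.2.1 h.2.2)

theorem mono {A' : Set V} (hA : A ⊆ A') (h : ReachWithin G A a b) : ReachWithin G A' a b :=
  h.map id fun _ ha _ hb hab => of_adj (hA ha) (hA hb) hab

theorem mem_of_closed {S : Set V} (hS : ∀ a ∈ A, ∀ b ∈ A, G.Adj a b → a ∈ S → b ∈ S)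
    (h : ReachWithin G A a b) (ha : a ∈ S) : b ∈ S := by
  induction h with
  | refl => exact ha
  | tail _ h ih => exact hS _ h.1 _ h.2.1 h.2.2 ih

end ReachWithin

section Components

variable {V W : Type*} {G : SimpleGraph V} {H : SimpleGraph W} {A : Set V} {B : Set W}

theorem induce_reachable_iff_reachWithin (a b : A) :
    (G.induce A).Reachable a b ↔ ReachWithin G A a b := by
  constructor
  · rw [SimpleGraph.reachable_iff_reflTransGen]
    intro h
    induction h with
    | refl => exact ReachWithin.refl _
    | @tail x y _ h ih => exact ih.trans (.of_adj x.2 y.2 h)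
  · obtain ⟨a, ha⟩ := a
    obtain ⟨b, hb⟩ := b
    intro h
    change ReachWithin G A a b at h
    induction h with
    | refl => exact SimpleGraph.Reachable.refl _
    | tail _ h ih =>
      exact (ih h.1).trans (SimpleGraph.Adj.reachable (by simpa using h.2.2))

theorem connectedComponentMk_eq_iff_reachWithin (a b : A) :
    (G.induce A).connectedComponentMk a = (G.induce A).connectedComponentMk b ↔
      ReachWithin G A a b := by
  rw [SimpleGraph.ConnectedComponent.eq, induce_reachable_iff_reachWithin]

/-- The map on connected components induced by a map sending edges to reachable pairs. -/
def componentMap (f : V → W) (hm : Set.MapsTo f A B)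
    (hf : ∀ a ∈ A, ∀ b ∈ A, G.Adj a b → ReachWithin H B (f a) (f b)) :
    (G.induce A).ConnectedComponent → (H.induce B).ConnectedComponent :=
  Quot.map (fun a => ⟨f a, hm a.2⟩) fun a b h =>
    (induce_reachable_iff_reachWithin _ _).2
      (((induce_reachable_iff_reachWithin a b).1 h).map f hf)

@[simp]
theorem componentMap_mk (f : V → W) (hm : Set.MapsTo f A B)
    (hf : ∀ a ∈ A, ∀ b ∈ A, G.Adj a b → ReachWithin H B (f a) (f b)) (a : A) :
    componentMap f hm hf ((G.induce A).connectedComponentMk a) =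
      (H.induce B).connectedComponentMk ⟨f a, hm a.2⟩ := rfl

theorem componentMap_injective (f : V → W) (hm : Set.MapsTo f A B)
    (hf : ∀ a ∈ A, ∀ b ∈ A, G.Adj a b → ReachWithin H B (f a) (f b))
    (hr : ∀ a ∈ A, ∀ b ∈ A, ReachWithin H B (f a) (f b) → ReachWithin G A a b) :
    Function.Injective (componentMap f hm hf) := by
  intro x y
  induction x using SimpleGraph.ConnectedComponent.ind with | _ x
  induction y using SimpleGraph.ConnectedComponent.ind with | _ y
  simp only [componentMap_mk, connectedComponentMk_eq_iff_reachWithin]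
  exact hr _ x.2 _ y.2

theorem componentMap_surjective (f : V → W) (hm : Set.MapsTo f A B)
    (hf : ∀ a ∈ A, ∀ b ∈ A, G.Adj a b → ReachWithin H B (f a) (f b))
    (hs : ∀ b ∈ B, ∃ a ∈ A, ReachWithin H B (f a) b) :
    Function.Surjective (componentMap f hm hf) := by
  intro y
  induction y using SimpleGraph.ConnectedComponent.ind with | _ y
  obtain ⟨a, ha, h⟩ := hs y y.2
  exact ⟨(G.induce A).connectedComponentMk ⟨a, ha⟩,
    (connectedComponentMk_eq_iff_reachWithin _ _).2 h⟩

end Components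

section Counting

variable {V : Type u} {W : Type u'} {G : SimpleGraph V} {H : SimpleGraph W}
  {A : Set V} {B : Set W}

theorem cComp_le_of_reflects [Finite W] (f : V → W) (hm : Set.MapsTo f A B)
    (hf : ∀ a ∈ A, ∀ b ∈ A, G.Adj a b → ReachWithin H B (f a) (f b))
    (hr : ∀ a ∈ A, ∀ b ∈ A, ReachWithin H B (f a) (f b) → ReachWithin G A a b) :
    cComp G A ≤ cComp H B :=
  Nat.card_le_card_of_injective _ (componentMap_injective f hm hf hr)

theorem cComp_le_of_covers [Finite V] (f : V → W) (hm : Set.MapsTo f A B)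
    (hf : ∀ a ∈ A, ∀ b ∈ A, G.Adj a b → ReachWithin H B (f a) (f b))
    (hs : ∀ b ∈ B, ∃ a ∈ A, ReachWithin H B (f a) b) :
    cComp H B ≤ cComp G A :=
  Nat.card_le_card_of_surjective _ (componentMap_surjective f hm hf hs)

/-- Adding an isolated vertex increases the number of components. -/
theorem cComp_add_one_le_of_isolated [Finite W] (f : V → W) (hm : Set.MapsTo f A B)
    (hf : ∀ a ∈ A, ∀ b ∈ A, G.Adj a b → ReachWithin H B (f a) (f b))
    (hr : ∀ a ∈ A, ∀ b ∈ A, ReachWithin H B (f a) (f b) → ReachWithin G A a b)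
    (w : W) (hw : w ∈ B) (hwf : ∀ a ∈ A, ¬ ReachWithin H B (f a) w) :
    cComp G A + 1 ≤ cComp H B := by
  have : Finite (G.induce A).ConnectedComponent :=
    Finite.of_injective _ (componentMap_injective f hm hf hr)
  rw [cComp, ← Finite.card_option]
  refine Nat.card_le_card_of_injective
    (fun o => o.elim ((H.induce B).connectedComponentMk ⟨w, hw⟩) (componentMap f hm hf)) ?_
  have key : ∀ x, componentMap f hm hf x ≠ (H.induce B).connectedComponentMk ⟨w, hw⟩ := by
    intro x
    induction x using SimpleGraph.ConnectedComponent.ind with | _ x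
    rw [componentMap_mk, Ne, connectedComponentMk_eq_iff_reachWithin]
    exact hwf _ x.2
  rintro (_ | x) (_ | y) h
  · rfl
  · exact absurd h.symm (key y)
  · exact absurd h (key x)
  · exact congrArg some (componentMap_injective f hm hf hr h)

theorem cComp_union_le [Finite V] (A B : Set V) :
    cComp G (A ∪ B) ≤ cComp G A + cComp G B := by
  rw [cComp, cComp, cComp, ← Nat.card_sum]
  have hA : ∀ a ∈ A, ∀ b ∈ A, G.Adj a b → ReachWithin G (A ∪ B) (id a) (id b) :=
    fun a ha b hb h => .of_adj (.inl ha) (.inl hb) h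
  have hB : ∀ a ∈ B, ∀ b ∈ B, G.Adj a b → ReachWithin G (A ∪ B) (id a) (id b) :=
    fun a ha b hb h => .of_adj (.inr ha) (.inr hb) h
  refine Nat.card_le_card_of_surjective
    (Sum.elim (componentMap id (fun _ => .inl) hA) (componentMap id (fun _ => .inr) hB)) ?_
  intro y
  induction y using SimpleGraph.ConnectedComponent.ind with | _ y
  obtain ⟨y, hy | hy⟩ := y
  · exact ⟨.inl ((G.induce A).connectedComponentMk ⟨y, hy⟩), rfl⟩
  · exact ⟨.inr ((G.induce B).connectedComponentMk ⟨y, hy⟩), rfl⟩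

/-- Collapsing one side of a one-vertex gluing onto the gluing vertex preserves reachability. -/
theorem ReachWithin.retract {A B : Set V} {v : V} (hinter : A ∩ B = {v})
    (hedge : ∀ a b : V, G.Adj a b → (a ∈ A ∧ b ∈ A) ∨ (a ∈ B ∧ b ∈ B))
    [DecidablePred (· ∈ A)] {X : Set V} {a b : V} (h : ReachWithin G X a b) :
    ReachWithin G (X ∩ A) (if a ∈ A then a else v) (if b ∈ A then b else v) := by
  have hv : ∀ x ∈ A, x ∈ B → x = v := fun x h1 h2 => by
    have : x ∈ A ∩ B := ⟨h1, h2⟩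
    simpa [hinter] using this
  refine h.map (fun a => if a ∈ A then a else v) fun a ha b hb hab => ?_
  by_cases h1 : a ∈ A <;> by_cases h2 : b ∈ A <;> simp only [h1, h2, if_true, if_false]
  · exact .of_adj ⟨ha, h1⟩ ⟨hb, h2⟩ hab
  · rcases hedge a b hab with h | h
    · exact absurd h.2 h2
    · rw [hv a h1 h.1]; exact .refl _
  · rcases hedge a b hab with h | h
    · exact absurd h.1 h1
    · rw [hv b h2 h.2]; exact .refl _
  · exact .refl _

theorem cComp_add_cComp_le [Finite V] {A B : Set V} {v : V} (hinter : A ∩ B = {v})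
    (hedge : ∀ a b : V, G.Adj a b → (a ∈ A ∧ b ∈ A) ∨ (a ∈ B ∧ b ∈ B)) :
    cComp G A + cComp G B ≤ cComp G Set.univ + 1 := by
  classical
  have hvA : v ∈ A := (hinter ▸ Set.mem_singleton v : v ∈ A ∩ B).1
  have hvB : v ∈ B := (hinter ▸ Set.mem_singleton v : v ∈ A ∩ B).2
  have hi (C : Set V) : ∀ a ∈ C, ∀ b ∈ C, G.Adj a b → ReachWithin G Set.univ (id a) (id b) :=
    fun a _ b _ h => .of_adj trivial trivial h
  have hrA : ∀ a b, ReachWithin G Set.univ a b →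
      ReachWithin G A (if a ∈ A then a else v) (if b ∈ A then b else v) := fun a b h =>
    (h.retract hinter hedge).mono (by simp)
  have hrB : ∀ a b, ReachWithin G Set.univ a b →
      ReachWithin G B (if a ∈ B then a else v) (if b ∈ B then b else v) := fun a b h =>
    (h.retract (A := B) (B := A) (by rw [Set.inter_comm, hinter])
      fun a b h => (hedge a b h).symm).mono (by simp)
  let fA : (G.induce A).ConnectedComponent → (G.induce Set.univ).ConnectedComponent :=
    componentMap id (fun _ _ => trivial) (hi A)
  let fB : (G.induce B).ConnectedComponent → (G.induce Set.univ).ConnectedComponent :=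
    componentMap id (fun _ _ => trivial) (hi B)
  have hfA : Function.Injective fA := componentMap_injective _ _ _ fun a ha b hb h => by
    simpa [ha, hb] using hrA a b h
  have hfB : Function.Injective fB := componentMap_injective _ _ _ fun a ha b hb h => by
    simpa [ha, hb] using hrB a b h
  let cv := (G.induce B).connectedComponentMk ⟨v, hvB⟩
  have hAB : ∀ x y, fA x = fB y → y = cv := by
    intro x y
    induction x using SimpleGraph.ConnectedComponent.ind with | _ x
    induction y using SimpleGraph.ConnectedComponent.ind with | _ y
    obtain ⟨x, hx⟩ := x
    obtain ⟨y, hy⟩ := y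
    intro h
    have h := (connectedComponentMk_eq_iff_reachWithin _ _).1 h
    refine (connectedComponentMk_eq_iff_reachWithin _ _).2 ?_
    have h' := hrB _ _ h
    have hxv : (if x ∈ B then x else v) = v := by
      split_ifs with hxB
      · have : x ∈ A ∩ B := ⟨hx, hxB⟩
        simpa [hinter] using this
      · rfl
    simp only [id, hxv, hy, if_true] at h'
    exact h'.symm
  rw [cComp, cComp, cComp, ← Nat.card_sum, ← Finite.card_option]
  refine Nat.card_le_card_of_injective
    (Sum.elim (fun x => some (fA x)) (fun y => if y = cv then none else some (fB y))) ?_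
  rintro (x | x) (y | y) h
  · simp only [Sum.elim_inl, Option.some.injEq] at h
    rw [hfA h]
  · simp only [Sum.elim_inl, Sum.elim_inr] at h
    split_ifs at h with hy
    exact absurd (hAB _ _ (Option.some.inj h)) hy
  · simp only [Sum.elim_inl, Sum.elim_inr] at h
    split_ifs at h with hx
    exact absurd (hAB _ _ (Option.some.inj h).symm) hx
  · simp only [Sum.elim_inr] at h
    split_ifs at h with hx hy hy
    · rw [hx, hy]
    · rw [hfB (Option.some.inj h)]

theorem cutVertexOn_iff [Finite V] {x : V} :
    CutVertexOn G A x ↔ x ∈ A ∧ ∃ a ∈ A \ {x}, ∃ b ∈ A \ {x},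
      G.Adj x a ∧ G.Adj x b ∧ ¬ ReachWithin G (A \ {x}) a b := by
  refine and_congr_right fun hxA => ?_
  have hi : ∀ a ∈ A \ {x}, ∀ b ∈ A \ {x}, G.Adj a b → ReachWithin G A (id a) (id b) :=
    fun a ha b hb h => .of_adj ha.1 hb.1 h
  constructor
  · intro h
    by_contra! hn
    refine absurd h (not_lt.2 (cComp_le_of_reflects id (fun _ h => h.1) hi ?_))
    intro a ha b hb h
    have key : ∀ u, ReachWithin G A a u → (u ≠ x → ReachWithin G (A \ {x}) a u) ∧
        (u = x → ∃ w ∈ A \ {x}, G.Adj x w ∧ ReachWithin G (A \ {x}) a w) := by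
      intro u hu
      induction hu with
      | refl => exact ⟨fun _ => .refl _, fun h => absurd h ha.2⟩
      | @tail y z _ hyz ih =>
        constructor
        · intro hz
          by_cases hy : y = x
          · subst hy
            obtain ⟨w, hw, hyw, hr⟩ := ih.2 rfl
            exact hr.trans (hn w hw z ⟨hyz.2.1, hz⟩ hyw hyz.2.2)
          · exact (ih.1 hy).trans (.of_adj ⟨hyz.1, hy⟩ ⟨hyz.2.1, hz⟩ hyz.2.2)
        · rintro rfl
          have hy : y ≠ z := hyz.2.2.ne
          exact ⟨y, ⟨hyz.1, hy⟩, hyz.2.2.symm, ih.1 hy⟩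
    exact (key b h).1 hb.2
  · rintro ⟨a, ha, b, hb, hxa, hxb, hab⟩
    have hs : Function.Surjective (componentMap (B := A) id (fun _ h => h.1) hi) := by
      refine componentMap_surjective _ _ _ fun y hy => ?_
      by_cases hyx : y = x
      · exact ⟨a, ha, hyx ▸ .of_adj ha.1 hxA hxa.symm⟩
      · exact ⟨y, ⟨hy, hyx⟩, .refl _⟩
    refine lt_of_le_of_ne (Nat.card_le_card_of_surjective _ hs) fun heq => hab ?_
    have hinj := ((Nat.bijective_iff_surjective_and_card _).2 ⟨hs, heq.symm⟩).1
    refine (connectedComponentMk_eq_iff_reachWithin (G := G) ⟨a, ha⟩ ⟨b, hb⟩).1 (hinj ?_)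
    exact (connectedComponentMk_eq_iff_reachWithin _ _).2
      ((ReachWithin.of_adj ha.1 hxA hxa.symm).trans (.of_adj hxA hb.1 hxb))

/-- For an unmixed graph, no set of vertices leaves more components than a cutset would. -/
theorem UnmixedOn.cComp_sdiff_le [DecidableEq V] (h : UnmixedOn G A) :
    ∀ T : Finset V, ↑T ⊆ A → cComp G (A \ ↑T) ≤ T.card + cComp G A := by
  intro T
  induction T using Finset.strongInduction with
  | H T ih =>
    intro hT
    by_cases hc : CutsetOn G A T
    · exact (h T hc).le
    · simp only [CutsetOn, hT, true_and, not_forall] at hc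
      obtain ⟨t, ht, hc⟩ := hc
      have hsub : T.erase t ⊆ T := Finset.erase_subset t T
      have h1 := ih _ (Finset.erase_ssubset ht) ((Finset.coe_subset.2 hsub).trans hT)
      have h2 : (A \ ↑(T.erase t)) \ {t} = A \ (↑T : Set V) := by
        ext x
        simp only [Set.mem_sdiff, Finset.mem_coe, Finset.mem_erase, Set.mem_singleton_iff]
        by_cases hx : x = t
        · simp [hx, ht]
        · simp [hx]
      have h3 : t ∈ A \ (↑(T.erase t) : Set V) := ⟨hT ht, by simp⟩
      have h4 : cComp G (A \ ↑T) ≤ cComp G (A \ ↑(T.erase t)) := by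
        rw [← h2]
        exact not_lt.1 fun h => hc ⟨h3, h⟩
      have := Finset.card_erase_lt_of_mem ht
      omega

end Counting

section Whisker

variable {V : Type u} {G : SimpleGraph V} {v : V} {X : Set V}

@[simp]
theorem whiskered_adj_inl_inl_s12 {a b : V} :
    (whiskered G {v}).Adj (.inl a) (.inl b) ↔ G.Adj a b := by
  simp only [whiskered, SimpleGraph.fromRel_adj]
  constructor
  · rintro ⟨_, (⟨x, y, h, hx, hy⟩ | ⟨x, _, _, hy⟩) | (⟨x, y, h, hx, hy⟩ | ⟨x, _, _, hy⟩)⟩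
    · cases hx; cases hy; exact h
    · cases hy
    · cases hx; cases hy; exact h.symm
    · cases hy
  · intro h
    exact ⟨by simpa using h.ne, .inl (.inl ⟨a, b, h, rfl, rfl⟩)⟩

@[simp]
theorem whiskered_adj_inl_inr_s12 {a b : V} :
    (whiskered G {v}).Adj (.inl a) (.inr b) ↔ a = v ∧ b = v := by
  simp only [whiskered, SimpleGraph.fromRel_adj]
  constructor
  · rintro ⟨_, (⟨x, y, h, hx, hy⟩ | ⟨x, hv, hx, hy⟩) | (⟨x, y, h, hx, hy⟩ | ⟨x, _, hx, hy⟩)⟩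
    · cases hy
    · cases hx; cases hy; exact ⟨hv, hv⟩
    · cases hx
    · cases hx
  · rintro ⟨rfl, rfl⟩
    exact ⟨by simp, .inl (.inr ⟨_, rfl, rfl, rfl⟩)⟩

@[simp]
theorem whiskered_adj_inr_inl {a b : V} :
    (whiskered G {v}).Adj (.inr a) (.inl b) ↔ a = v ∧ b = v := by
  rw [SimpleGraph.adj_comm, whiskered_adj_inl_inr_s12, and_comm]

@[simp]
theorem whiskered_not_adj_inr_inr_s12 {a b : V} : ¬ (whiskered G {v}).Adj (.inr a) (.inr b) := by
  simp only [whiskered, SimpleGraph.fromRel_adj]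
  rintro ⟨_, (⟨x, y, h, hx, hy⟩ | ⟨x, hv, hx, hy⟩) | (⟨x, y, h, hx, hy⟩ | ⟨x, _, hx, hy⟩)⟩
  · cases hx
  · cases hx
  · cases hx
  · cases hx

theorem reachWithin_whiskered_iff {a b : V} :
    ReachWithin (whiskered G {v}) (Sum.inl '' X ∪ Sum.inr '' {v}) (.inl a) (.inl b) ↔
      ReachWithin G X a b := by
  constructor
  · intro h
    refine h.map (Sum.elim id fun _ => v) ?_
    rintro (a | a) ha (b | b) hb hab
    · exact .of_adj (by simpa using ha) (by simpa using hb) (by simpa using hab)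
    · rw [whiskered_adj_inl_inr_s12] at hab
      rw [hab.1]
      exact .refl _
    · rw [whiskered_adj_inr_inl] at hab
      rw [hab.2]
      exact .refl _
    · exact absurd hab whiskered_not_adj_inr_inr_s12
  · intro h
    exact h.map Sum.inl fun a ha b hb hab =>
      .of_adj (by simpa using ha) (by simpa using hb) (by simpa using hab)

theorem not_reachWithin_whiskered_inr (hv : v ∉ X) (a : V) :
    ¬ ReachWithin (whiskered G {v}) (Sum.inl '' X ∪ Sum.inr '' {v}) (.inl a) (.inr v) := by
  intro h
  have : (Sum.inr v : V ⊕ V) ∈ Set.range (Sum.inl : V → V ⊕ V) := by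
    refine h.mem_of_closed (S := Set.range Sum.inl) ?_ ⟨a, rfl⟩
    rintro _ ha (b | b) - hab ⟨c, rfl⟩
    · exact ⟨b, rfl⟩
    · rw [whiskered_adj_inl_inr_s12] at hab
      rw [hab.1] at ha
      simp [hv] at ha
  simp at this

variable (G v X)

theorem cComp_le_cComp_whiskered [Finite V] :
    cComp G X ≤ cComp (whiskered G {v}) (Sum.inl '' X ∪ Sum.inr '' {v}) :=
  cComp_le_of_reflects Sum.inl (fun a ha => by simpa using ha)
    (fun _ ha _ hb hab => reachWithin_whiskered_iff.2 (.of_adj ha hb hab))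
    (fun _ _ _ _ h => reachWithin_whiskered_iff.1 h)

variable {v X}

theorem cComp_add_one_le_cComp_whiskered [Finite V] (hv : v ∉ X) :
    cComp G X + 1 ≤ cComp (whiskered G {v}) (Sum.inl '' X ∪ Sum.inr '' {v}) :=
  cComp_add_one_le_of_isolated Sum.inl (fun a ha => by simpa using ha)
    (fun _ ha _ hb hab => reachWithin_whiskered_iff.2 (.of_adj ha hb hab))
    (fun _ _ _ _ h => reachWithin_whiskered_iff.1 h) (.inr v) (by simp)
    (fun a _ => not_reachWithin_whiskered_inr hv a)

theorem cComp_whiskered_le [Finite V] (hv : v ∈ X) :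
    cComp (whiskered G {v}) (Sum.inl '' X ∪ Sum.inr '' {v}) ≤ cComp G X := by
  refine cComp_le_of_covers Sum.inl (fun a ha => by simpa using ha)
    (fun _ ha _ hb hab => reachWithin_whiskered_iff.2 (.of_adj ha hb hab)) ?_
  rintro _ (⟨a, ha, rfl⟩ | ⟨_, rfl, rfl⟩)
  · exact ⟨a, ha, .refl _⟩
  · exact ⟨_, hv, .of_adj (by simpa using hv) (by simp) (by simp)⟩

variable {G}

theorem whiskered_sdiff_inl (t : V) :
    (Sum.inl '' X ∪ Sum.inr '' {v} : Set (V ⊕ V)) \ {.inl t} =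
      Sum.inl '' (X \ {t}) ∪ Sum.inr '' {v} := by
  ext (x | x) <;> simp

theorem cutVertexOn_whiskered_self [Finite V] (hv : v ∈ X) :
    CutVertexOn (whiskered G {v}) (Sum.inl '' X ∪ Sum.inr '' {v}) (.inl v) ↔
      ∃ a ∈ X, G.Adj v a := by
  rw [cutVertexOn_iff, whiskered_sdiff_inl]
  constructor
  · rintro ⟨-, a, ha, b, hb, hva, hvb, hab⟩
    rcases a with a | a
    · exact ⟨a, by simp at ha; exact ha.1, by simpa using hva⟩
    rcases b with b | b
    · exact ⟨b, by simp at hb; exact hb.1, by simpa using hvb⟩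
    · simp only [whiskered_adj_inl_inr_s12, true_and] at hva hvb
      rw [hva, hvb] at hab
      exact absurd (.refl _) hab
  · rintro ⟨a, ha, hva⟩
    refine ⟨by simpa using hv, .inl a, by simp [ha, hva.ne'], .inr v, by simp, by simpa using hva,
      by simp, not_reachWithin_whiskered_inr (by simp) a⟩

variable {A B : Set V}

theorem cutVertexOn_whiskered_iff [Finite V] (hinter : A ∩ B = {v})
    (hedge : ∀ a b : V, G.Adj a b → (a ∈ A ∧ b ∈ A) ∨ (a ∈ B ∧ b ∈ B))
    {t : V} (htA : t ∈ A) (htv : t ≠ v) :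
    CutVertexOn (whiskered G {v}) (Sum.inl '' (X ∩ A) ∪ Sum.inr '' {v}) (.inl t) ↔
      CutVertexOn G X t := by
  classical
  have hnb : ∀ a, G.Adj t a → a ∈ A := fun a h => by
    rcases hedge t a h with h | h
    · exact h.2
    · have : t ∈ A ∩ B := ⟨htA, h.1⟩
      rw [hinter] at this
      exact absurd this htv
  have hset : (X ∩ A) \ {t} = (X \ {t}) ∩ A := by
    ext x; simp only [Set.mem_sdiff, Set.mem_inter_iff]; tauto
  rw [cutVertexOn_iff, cutVertexOn_iff, whiskered_sdiff_inl, hset]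
  constructor
  · rintro ⟨ht, a, ha, b, hb, hta, htb, hab⟩
    rcases a with a | a
    swap
    · simp [htv] at hta
    rcases b with b | b
    swap
    · simp [htv] at htb
    simp only [whiskered_adj_inl_inl_s12] at hta htb
    rw [reachWithin_whiskered_iff] at hab
    refine ⟨by simp at ht; exact ht.1, a, by simp at ha; simpa using ha.1, b,
      by simp at hb; simpa using hb.1, hta, htb, fun h => hab ?_⟩
    simpa [hnb a hta, hnb b htb] using h.retract hinter hedge
  · rintro ⟨ht, a, ha, b, hb, hta, htb, hab⟩
    refine ⟨by simp [ht, htA], .inl a, ?_, .inl b, ?_, by simpa using hta, by simpa using htb, ?_⟩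
    · simpa [hnb a hta] using ha
    · simpa [hnb b htb] using hb
    · rw [reachWithin_whiskered_iff]
      exact fun h => hab (h.mono Set.inter_subset_left)

/-- A vertex separating `A` from `B` with neighbours on both sides is a cut vertex. -/
theorem cutVertexOn_of_neighbors [Finite V] (hinter : A ∩ B = {v})
    (hedge : ∀ a b : V, G.Adj a b → (a ∈ A ∧ b ∈ A) ∨ (a ∈ B ∧ b ∈ B))
    (hv : v ∈ X) {a b : V} (ha : a ∈ X ∩ A) (hb : b ∈ X ∩ B) (hva : G.Adj v a)
    (hvb : G.Adj v b) : CutVertexOn G X v := by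
  have hAB : ∀ x ∈ A, x ∈ B → x = v := fun x h1 h2 => by
    have : x ∈ A ∩ B := ⟨h1, h2⟩
    simpa [hinter] using this
  refine cutVertexOn_iff.2 ⟨hv, a, ⟨ha.1, hva.ne'⟩, b, ⟨hb.1, hvb.ne'⟩, hva, hvb, fun h => ?_⟩
  have hbA : b ∈ A := by
    refine h.mem_of_closed (S := A) ?_ ha.2
    intro x hx y _ hxy hxA
    rcases hedge x y hxy with h | h
    · exact h.2
    · exact absurd (hAB x hxA h.1) hx.2
  exact hvb.ne' (hAB b hbA hb.2)

end Whisker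

section WhiskerCutset

open Classical in
/-- The part of `T` lying in `A`, viewed among the original vertices of a whiskered graph. -/
noncomputable def inlPart {V : Type u} (A : Set V) (T : Finset V) : Finset (V ⊕ V) :=
  (T.filter (· ∈ A)).map Function.Embedding.inl

variable {V : Type u} {G : SimpleGraph V} {v : V} {A B : Set V}

@[simp]
theorem inl_mem_inlPart {T : Finset V} {t : V} : .inl t ∈ inlPart A T ↔ t ∈ T ∧ t ∈ A := by
  simp [inlPart]

@[simp]
theorem inr_notMem_inlPart {T : Finset V} {t : V} : .inr t ∉ inlPart A T := by
  simp [inlPart]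

theorem sdiff_inlPart (T : Finset V) :
    (Sum.inl '' A ∪ Sum.inr '' {v} : Set (V ⊕ V)) \ ↑(inlPart A T) =
      Sum.inl '' ((↑T : Set V)ᶜ ∩ A) ∪ Sum.inr '' {v} := by
  ext (x | x) <;> simp; tauto

theorem coe_inlPart_subset (T : Finset V) :
    (↑(inlPart A T) : Set (V ⊕ V)) ⊆ Sum.inl '' A ∪ Sum.inr '' {v} := by
  rintro (x | x) hx
  · simp at hx; simp [hx.2]
  · simp at hx

variable [DecidableEq V]

theorem inlPart_erase (T : Finset V) (t : V) :
    inlPart A (T.erase t) = (inlPart A T).erase (.inl t) := by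
  ext (x | x) <;> simp; tauto

theorem inlPart_erase_of_notMem (T : Finset V) {t : V} (ht : t ∉ A) :
    inlPart A (T.erase t) = inlPart A T := by
  ext (x | x) <;> simp
  rintro hx - rfl
  exact ht hx

/-- Cutsets of the whiskered side `A`, in terms of the glued graph. -/
theorem cutsetOn_whiskered_iff [Finite V] (hinter : A ∩ B = {v})
    (hedge : ∀ a b : V, G.Adj a b → (a ∈ A ∧ b ∈ A) ∨ (a ∈ B ∧ b ∈ B)) (T : Finset V) :
    CutsetOn (whiskered G {v}) (Sum.inl '' A ∪ Sum.inr '' {v}) (inlPart A T) ↔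
      (∀ t ∈ T, t ∈ A → t ≠ v → CutVertexOn G (↑(T.erase t) : Set V)ᶜ t) ∧
      (v ∈ T → ∃ a ∈ A, a ∉ T ∧ G.Adj v a) := by
  have hvA : v ∈ A := (hinter ▸ Set.mem_singleton v : v ∈ A ∩ B).1
  have hself : CutVertexOn (whiskered G {v})
      (Sum.inl '' ((↑(T.erase v) : Set V)ᶜ ∩ A) ∪ Sum.inr '' {v}) (.inl v) ↔
      ∃ a ∈ A, a ∉ T ∧ G.Adj v a := by
    rw [cutVertexOn_whiskered_self (by simp [hvA])]
    refine exists_congr fun a => ?_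
    simp only [Finset.coe_erase, Set.mem_inter_iff, Set.mem_compl_iff, Set.mem_sdiff,
      Finset.mem_coe, Set.mem_singleton_iff]
    constructor
    · rintro ⟨⟨h1, h2⟩, h3⟩
      exact ⟨h2, fun h => h1 ⟨h, h3.ne'⟩, h3⟩
    · rintro ⟨h1, h2, h3⟩
      exact ⟨⟨fun h => h2 h.1, h1⟩, h3⟩
  constructor
  · rintro ⟨-, h⟩
    refine ⟨fun t ht htA htv => ?_, fun hv => ?_⟩
    · have := h (.inl t) (by simp [ht, htA])
      rwa [← inlPart_erase, sdiff_inlPart, cutVertexOn_whiskered_iff hinter hedge htA htv] at this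
    · have := h (.inl v) (by simp [hv, hvA])
      rwa [← inlPart_erase, sdiff_inlPart, hself] at this
  · rintro ⟨h1, h2⟩
    refine ⟨coe_inlPart_subset T, ?_⟩
    rintro (t | t) ht
    · rw [inl_mem_inlPart] at ht
      rw [← inlPart_erase, sdiff_inlPart]
      by_cases htv : t = v
      · subst htv
        exact hself.2 (h2 ht.1)
      · exact (cutVertexOn_whiskered_iff hinter hedge ht.2 htv).2 (h1 t ht.1 ht.2 htv)
    · simp at ht

/-- If the whiskered sides are unmixed, a cutset of the unmixed graph `G` containing the gluing
vertex leaves it a neighbour in `B`. -/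
theorem exists_neighbor_of_cutsetOn [Finite V] (hinter : A ∩ B = {v})
    (hunion : A ∪ B = Set.univ)
    (hedge : ∀ a b : V, G.Adj a b → (a ∈ A ∧ b ∈ A) ∨ (a ∈ B ∧ b ∈ B))
    (hG : UnmixedOn G Set.univ)
    (hA : UnmixedOn (whiskered G {v}) (Sum.inl '' A ∪ Sum.inr '' {v}))
    (hB : UnmixedOn (whiskered G {v}) (Sum.inl '' B ∪ Sum.inr '' {v}))
    {T : Finset V} (hT : CutsetOn G Set.univ T) (hv : v ∈ T) :
    ∃ b ∈ B, b ∉ T ∧ G.Adj v b := by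
  classical
  by_contra! hn
  have hvA : v ∈ A := (hinter ▸ Set.mem_singleton v : v ∈ A ∩ B).1
  have hvB : v ∈ B := (hinter ▸ Set.mem_singleton v : v ∈ A ∩ B).2
  have h1 := hG T hT
  rw [← Set.compl_eq_univ_sdiff] at h1
  have h2 : cComp G (↑T : Set V)ᶜ ≤ cComp G ((↑T : Set V)ᶜ ∩ A) + cComp G ((↑T : Set V)ᶜ ∩ B) := by
    have := cComp_union_le (G := G) ((↑T : Set V)ᶜ ∩ A) ((↑T : Set V)ᶜ ∩ B)
    rwa [← Set.inter_union_distrib_left, hunion, Set.inter_univ] at this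
  have h3 := hA.cComp_sdiff_le _ (coe_inlPart_subset T)
  rw [sdiff_inlPart] at h3
  have h4 := cComp_add_one_le_cComp_whiskered G (v := v) (X := (↑T : Set V)ᶜ ∩ A) (by simp [hv])
  have h5 := cComp_whiskered_le G hvA
  have h6 := hB.cComp_sdiff_le _ (coe_inlPart_subset (T.erase v))
  rw [sdiff_inlPart] at h6
  have h7 := cComp_le_cComp_whiskered G v ((↑(T.erase v) : Set V)ᶜ ∩ B)
  have h8 := cComp_whiskered_le G hvB
  have h9 : cComp G ((↑T : Set V)ᶜ ∩ B) + 1 ≤ cComp G ((↑(T.erase v) : Set V)ᶜ ∩ B) := by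
    have hsub : (↑T : Set V)ᶜ ∩ B ⊆ (↑(T.erase v) : Set V)ᶜ ∩ B :=
      Set.inter_subset_inter_left _ (Set.compl_subset_compl.2
        (Finset.coe_subset.2 (Finset.erase_subset v T)))
    have hadj : ∀ a ∈ (↑(T.erase v) : Set V)ᶜ ∩ B, ¬ G.Adj v a := by
      rintro a ⟨ha, haB⟩ hva
      refine hn a haB (fun haT => ha ?_) hva
      simp [haT, hva.ne']
    refine cComp_add_one_le_of_isolated id hsub
      (fun a ha b hb hab => .of_adj (hsub ha) (hsub hb) hab) ?_ v (by simp [hvB]) ?_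
    · intro a ha b hb h
      refine h.map id fun x hx y hy hxy => .of_adj ⟨fun hxT => ?_, hx.2⟩ ⟨fun hyT => ?_, hy.2⟩ hxy
      · by_cases hxv : x = v
        · exact hadj y hy (hxv ▸ hxy)
        · exact hx.1 (by simpa [hxv] using hxT)
      · by_cases hyv : y = v
        · exact hadj x hx (hyv ▸ hxy.symm)
        · exact hy.1 (by simpa [hyv] using hyT)
    · intro a ha h
      refine h.mem_of_closed (S := {v}ᶜ) ?_ ?_ rfl
      · rintro x hx y hy hxy - rfl
        exact hadj x hx hxy.symm
      · rintro rfl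
        exact ha.1 hv
  have h10 := cComp_add_cComp_le hinter hedge
  have h11 : (inlPart A T).card + (inlPart B (T.erase v)).card = T.card := by
    rw [inlPart, inlPart, Finset.card_map, Finset.card_map,
      ← Finset.card_filter_add_card_filter_not (s := T) (· ∈ A)]
    congr 2
    ext x
    have hu : x ∈ A ∪ B := hunion ▸ Set.mem_univ x
    have hx : x ∈ A ∩ B ↔ x = v := by rw [hinter]; rfl
    simp only [Finset.mem_filter, Finset.mem_erase, Set.mem_union, Set.mem_inter_iff] at *
    tauto
  omega

/-- Cutsets of the glued graph are obtained by gluing cutsets of the whiskered sides. -/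
theorem cutsetOn_univ_iff [Finite V] (hinter : A ∩ B = {v})
    (hunion : A ∪ B = Set.univ)
    (hedge : ∀ a b : V, G.Adj a b → (a ∈ A ∧ b ∈ A) ∨ (a ∈ B ∧ b ∈ B))
    (hG : UnmixedOn G Set.univ)
    (hA : UnmixedOn (whiskered G {v}) (Sum.inl '' A ∪ Sum.inr '' {v}))
    (hB : UnmixedOn (whiskered G {v}) (Sum.inl '' B ∪ Sum.inr '' {v}))
    (T : Finset V) :
    CutsetOn G Set.univ T ↔
      CutsetOn (whiskered G {v}) (Sum.inl '' A ∪ Sum.inr '' {v}) (inlPart A T) ∧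
      CutsetOn (whiskered G {v}) (Sum.inl '' B ∪ Sum.inr '' {v}) (inlPart B T) := by
  have hinter' : B ∩ A = {v} := by rw [Set.inter_comm, hinter]
  have hunion' : B ∪ A = Set.univ := by rw [Set.union_comm, hunion]
  have hedge' : ∀ a b : V, G.Adj a b → (a ∈ B ∧ b ∈ B) ∨ (a ∈ A ∧ b ∈ A) :=
    fun a b h => (hedge a b h).symm
  rw [cutsetOn_whiskered_iff hinter hedge, cutsetOn_whiskered_iff hinter' hedge']
  constructor
  · intro hT
    have hcut : ∀ t ∈ T, CutVertexOn G (↑(T.erase t) : Set V)ᶜ t := fun t ht => by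
      rw [Set.compl_eq_univ_sdiff]
      exact hT.2 t ht
    exact ⟨⟨fun t ht _ _ => hcut t ht,
        exists_neighbor_of_cutsetOn hinter' hunion' hedge' hG hB hA hT⟩,
      ⟨fun t ht _ _ => hcut t ht,
        exists_neighbor_of_cutsetOn hinter hunion hedge hG hA hB hT⟩⟩
  · rintro ⟨⟨hA1, hA2⟩, hB1, hB2⟩
    refine ⟨Set.subset_univ _, fun t ht => ?_⟩
    rw [← Set.compl_eq_univ_sdiff]
    by_cases htv : t = v
    · subst htv
      obtain ⟨a, ha, haT, hva⟩ := hA2 ht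
      obtain ⟨b, hb, hbT, hvb⟩ := hB2 ht
      exact cutVertexOn_of_neighbors hinter hedge (by simp) ⟨by simp [haT], ha⟩
        ⟨by simp [hbT], hb⟩ hva hvb
    · have hu : t ∈ A ∪ B := hunion ▸ Set.mem_univ t
      exact hu.elim (fun h => hA1 t ht h htv) (fun h => hB1 t ht h htv)

theorem AccessibleOn.exists_erase_inlPart
    (h : AccessibleOn (whiskered G {v}) (Sum.inl '' A ∪ Sum.inr '' {v})) {T : Finset V}
    (hT : CutsetOn (whiskered G {v}) (Sum.inl '' A ∪ Sum.inr '' {v}) (inlPart A T))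
    (hne : ∃ t ∈ T, t ∈ A) :
    ∃ t ∈ T, t ∈ A ∧
      CutsetOn (whiskered G {v}) (Sum.inl '' A ∪ Sum.inr '' {v}) (inlPart A (T.erase t)) := by
  obtain ⟨t, ht, htA⟩ := hne
  obtain ⟨s | s, hs, hc⟩ := h.2 _ hT ⟨.inl t, by simp [ht, htA]⟩
  · rw [inl_mem_inlPart] at hs
    exact ⟨s, hs.1, hs.2, by rwa [inlPart_erase]⟩
  · simp at hs

/-- If both parts of `T` are cutsets of accessible whiskered sides and `T` meets `A`, then some
vertex can be deleted from `T` with both parts remaining cutsets. -/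
theorem exists_erase_of_whiskered (hinter : A ∩ B = {v})
    (hA : AccessibleOn (whiskered G {v}) (Sum.inl '' A ∪ Sum.inr '' {v}))
    (hB : AccessibleOn (whiskered G {v}) (Sum.inl '' B ∪ Sum.inr '' {v})) {T : Finset V}
    (hTA : CutsetOn (whiskered G {v}) (Sum.inl '' A ∪ Sum.inr '' {v}) (inlPart A T))
    (hTB : CutsetOn (whiskered G {v}) (Sum.inl '' B ∪ Sum.inr '' {v}) (inlPart B T))
    (hne : ∃ t ∈ T, t ∈ A) :
    ∃ t ∈ T,
      CutsetOn (whiskered G {v}) (Sum.inl '' A ∪ Sum.inr '' {v}) (inlPart A (T.erase t)) ∧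
      CutsetOn (whiskered G {v}) (Sum.inl '' B ∪ Sum.inr '' {v}) (inlPart B (T.erase t)) := by
  have hvB : v ∈ B := (hinter ▸ Set.mem_singleton v : v ∈ A ∩ B).2
  have hAB : ∀ x ∈ A, x ∈ B → x = v := fun x h1 h2 => by
    have : x ∈ A ∩ B := ⟨h1, h2⟩
    simpa [hinter] using this
  obtain ⟨t, ht, htA, hc⟩ := hA.exists_erase_inlPart hTA hne
  by_cases htv : t = v
  · subst htv
    obtain ⟨s, hs, hsB, hc'⟩ := hB.exists_erase_inlPart hTB ⟨t, ht, hvB⟩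
    by_cases hst : s = t
    · subst hst
      exact ⟨s, hs, hc, hc'⟩
    · refine ⟨s, hs, ?_, hc'⟩
      rwa [inlPart_erase_of_notMem T fun h => hst (hAB s h hsB)]
  · refine ⟨t, ht, hc, ?_⟩
    rwa [inlPart_erase_of_notMem T fun h => htv (hAB t htA h)]

end WhiskerCutset

/-- for `G = G₁ ∪ G₂` with `V(G₁) ∩ V(G₂) = {v}`, let `Ḡᵢ` be `Gᵢ`
with a whisker `{v, f_v}` attached at `v`. If `J_G` is unmixed and `Ḡ₁`, `Ḡ₂` are
accessible, then `G` is accessible. -/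
theorem accessible_of_whisker_union {V : Type u} [Fintype V] [DecidableEq V]
    (G : SimpleGraph V) (A₁ A₂ : Set V) (v : V)
    (hunion : A₁ ∪ A₂ = Set.univ) (hinter : A₁ ∩ A₂ = {v})
    (hedge : ∀ a b : V, G.Adj a b → (a ∈ A₁ ∧ b ∈ A₁) ∨ (a ∈ A₂ ∧ b ∈ A₂))
    (hunm : UnmixedOn G Set.univ)
    (ha1 : AccessibleOn (whiskered G ({v} : Set V))
        (Sum.inl '' A₁ ∪ Sum.inr '' ({v} : Set V)))
    (ha2 : AccessibleOn (whiskered G ({v} : Set V))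
        (Sum.inl '' A₂ ∪ Sum.inr '' ({v} : Set V))) :
    AccessibleOn G Set.univ := by
  have hiff := cutsetOn_univ_iff hinter hunion hedge hunm ha1.1 ha2.1
  refine ⟨hunm, fun T hT hne => ?_⟩
  obtain ⟨h1, h2⟩ := (hiff T).1 hT
  obtain ⟨t, ht⟩ := hne
  have htu : t ∈ A₁ ∪ A₂ := hunion ▸ Set.mem_univ t
  rcases htu with htA | htA
  · obtain ⟨s, hs, hs1, hs2⟩ := exists_erase_of_whiskered hinter ha1 ha2 h1 h2 ⟨t, ht, htA⟩
    exact ⟨s, hs, (hiff _).2 ⟨hs1, hs2⟩⟩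
  · obtain ⟨s, hs, hs2, hs1⟩ := exists_erase_of_whiskered (by rw [Set.inter_comm, hinter])
      ha2 ha1 h2 h1 ⟨t, ht, htA⟩
    exact ⟨s, hs, (hiff _).2 ⟨hs1, hs2⟩⟩
end
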